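/- Suppose a linear map T and a set Ω satisfy: for every V with T(V) = 0, ‖V_Ω‖₁ ≤ (ε/(1−2ε))·‖V‖₁ for some ε ∈ (0, 1/4) (equivalently ‖(V)_Ω‖₁ ≤ (2ε/(1−2ε))‖V‖₁ applied to V = X* − X). Then for an arbitrary matrix X, any minimizer X* of ‖X̃‖₁ subject to T(X̃) = T(X) satisfies ‖X* − X‖₁ ≤ ((2−4ε)/(1−4ε))·‖X_{Ω^c}‖₁. -/

import Mathlib

open Finset

/-- Entrywise ℓ1 norm of a matrix. -/
noncomputable def matL1 {p q : ℕ} (M : Matrix (Fin p) (Fin q) ℝ) : ℝ :=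
  ∑ i, ∑ j, |M i j|

/-- Restriction of a matrix to an index set `Ω` (zero outside `Ω`). -/
def matRestrict {p : ℕ} (Ω : Finset (Fin p × Fin p)) (M : Matrix (Fin p) (Fin p) ℝ) :
    Matrix (Fin p) (Fin p) ℝ :=
  fun i j => if (i, j) ∈ Ω then M i j else 0

/-- Under the nullspace property
`‖V_Ω‖₁ ≤ (ε/(1−2ε))‖V‖₁` for all `V ∈ ker T`, with `ε ∈ (0,1/4)`, any ℓ1 minimizer
`X*` subject to `T(X̃) = T(X)` satisfies
`‖X* − X‖₁ ≤ ((2−4ε)/(1−4ε))‖X_{Ωᶜ}‖₁` for an arbitrary matrix `X`. -/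
theorem nullspace_property_approx_recovery {p m : ℕ}
    (T : Matrix (Fin p) (Fin p) ℝ →ₗ[ℝ] Matrix (Fin m) (Fin m) ℝ)
    (Ω : Finset (Fin p × Fin p)) (ε : ℝ) (hε : ε ∈ Set.Ioo (0 : ℝ) (1/4))
    (hNSP : ∀ V : Matrix (Fin p) (Fin p) ℝ, T V = 0 →
      matL1 (matRestrict Ω V) ≤ (ε / (1 - 2 * ε)) * matL1 V)
    (X Xstar : Matrix (Fin p) (Fin p) ℝ)
    (hfeas : T Xstar = T X)
    (hopt : ∀ X' : Matrix (Fin p) (Fin p) ℝ, T X' = T X → matL1 Xstar ≤ matL1 X') :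
    matL1 (Xstar - X) ≤ ((2 - 4 * ε) / (1 - 4 * ε)) * matL1 (matRestrict Ωᶜ X) := by
  obtain ⟨h0, h1⟩ := hε
  have hV := hNSP (Xstar - X) (by rw [map_sub, hfeas, sub_self])
  have hX := hopt X rfl
  have key : matL1 (Xstar - X) + matL1 X ≤
      matL1 Xstar + 2 * matL1 (matRestrict Ω (Xstar - X)) + 2 * matL1 (matRestrict Ωᶜ X) := by
    simp only [matL1, Finset.mul_sum, ← Finset.sum_add_distrib]
    refine Finset.sum_le_sum fun i _ => Finset.sum_le_sum fun j _ => ?_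
    have a1 := abs_sub (Xstar i j) (X i j)
    have a2 := abs_sub_abs_le_abs_sub (X i j) (Xstar i j)
    rw [abs_sub_comm] at a2
    by_cases h : (i, j) ∈ Ω
    · simp [matRestrict, h]
      linarith
    · simp [matRestrict, h]
      linarith
  have h2 : 0 < 1 - 2 * ε := by linarith
  have h4 : 0 < 1 - 4 * ε := by linarith
  rw [div_mul_eq_mul_div, le_div_iff₀ h2] at hV
  rw [div_mul_eq_mul_div, le_div_iff₀ h4]
  have k : matL1 (Xstar - X) ≤
      2 * matL1 (matRestrict Ω (Xstar - X)) + 2 * matL1 (matRestrict Ωᶜ X) := by linarith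
  have k2 := mul_le_mul_of_nonneg_right k h2.le
  linarith
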